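/- The derived algebra K = (g ⊗ F[t,t⁻¹]) ⊕ Fc of an untwisted affine Kac-Moody algebra, with c central and [x⊗tᵐ, y⊗tⁿ] = [x,y]⊗t^{m+n} + (x|y) m δ_{m,−n} c, where (·|·) is the Killing form of the finite-dimensional split simple Lie algebra g, has centroid equal to F·id. -/

import Mathlib

open scoped TensorProduct
open LaurentPolynomial

section Centroid

variable {F g : Type*} [Field F] [LieRing g] [LieAlgebra F g]

namespace LieAlgebra

/-- An element of the centroid of a simple Lie algebra which has an eigenvector is a scalar. -/
lemma IsSimple.eq_smul_of_centroid_of_eigenvector [IsSimple F g]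
    {φ : Module.End F g} (hφ : ∀ x y : g, φ ⁅x, y⁆ = ⁅x, φ y⁆)
    {a : F} {v : g} (hv : v ≠ 0) (hav : φ v = a • v) (x : g) : φ x = a • x := by
  let I : LieIdeal F g :=
    { LinearMap.ker (φ - a • LinearMap.id) with
      lie_mem := fun {x y} hy ↦ by
        have hy' : φ y = a • y := by
          simpa [sub_eq_zero] using hy
        simp [hφ, hy'] }
  have mem_I (y : g) : y ∈ I ↔ φ y = a • y := by
    change y ∈ LinearMap.ker (φ - a • LinearMap.id) ↔ _
    simp [sub_eq_zero]
  have hI : I = ⊤ := by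
    refine (IsSimple.eq_bot_or_eq_top I).resolve_left fun h ↦ hv ?_
    have := (mem_I v).2 hav
    simpa [h] using this
  exact (mem_I x).1 (hI ▸ LieSubmodule.mem_top x)

/-- A nontrivial Killing Lie algebra has a root relative to any splitting Cartan subalgebra. -/
lemma IsKilling.exists_weight_isNonZero [CharZero F] [FiniteDimensional F g] [IsKilling F g]
    [Nontrivial g] (H : LieSubalgebra F g) [H.IsCartanSubalgebra]
    [LieModule.IsTriangularizable F H g] :
    ∃ α : LieModule.Weight F H g, α.IsNonZero := by
  by_contra! h
  have hspan := IsKilling.span_weight_isNonZero_eq_top F g H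
  have hempty : {α : LieModule.Weight F H g | α.IsNonZero} = ∅ := by
    ext α
    simpa using h α
  rw [hempty, Set.image_empty, Submodule.span_empty] at hspan
  have hdual : Subsingleton (Module.Dual F H) :=
    (Submodule.subsingleton_iff F).1 (subsingleton_of_bot_eq_top hspan)
  have hH : Subsingleton H := by
    rwa [Module.subsingleton_dual_iff] at hdual
  obtain ⟨x, hx⟩ := exists_ne (0 : g)
  have hmem : x ∈ H.normalizer := by
    rw [LieSubalgebra.mem_normalizer_iff]
    intro y hy
    have : (⟨y, hy⟩ : H) = 0 := Subsingleton.elim _ _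
    rw [show y = 0 from congrArg Subtype.val this]
    simp
  rw [LieSubalgebra.IsCartanSubalgebra.self_normalizing] at hmem
  exact hx (congrArg Subtype.val (Subsingleton.elim (⟨x, hmem⟩ : H) 0))

/-- A split simple Lie algebra of characteristic zero is central. -/
lemma IsSimple.exists_eq_smul_of_centroid [CharZero F] [FiniteDimensional F g] [IsSimple F g]
    (H : LieSubalgebra F g) [H.IsCartanSubalgebra] [LieModule.IsTriangularizable F H g]
    {φ : Module.End F g} (hφ : ∀ x y : g, φ ⁅x, y⁆ = ⁅x, φ y⁆) :
    ∃ a : F, ∀ x, φ x = a • x := by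
  have := IsSimple.nontrivial F (L := g)
  obtain ⟨α, hα⟩ := IsKilling.exists_weight_isNonZero (F := F) H
  obtain ⟨⟨v, hv⟩, hv0, hspan⟩ :=
    finrank_eq_one_iff'.1 (IsKilling.finrank_rootSpace_eq_one α hα)
  have hφv : φ v ∈ rootSpace H α := by
    refine LieModule.weightSpace_le_genWeightSpace g α ?_
    rw [LieModule.mem_weightSpace]
    intro h
    have hh := IsKilling.lie_eq_smul_of_mem_rootSpace hv h
    rw [LieSubalgebra.coe_bracket_of_module] at hh ⊢
    rw [← hφ, hh, map_smul]
  obtain ⟨a, ha⟩ := hspan ⟨φ v, hφv⟩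
  refine ⟨a, IsSimple.eq_smul_of_centroid_of_eigenvector hφ (v := v) ?_ ?_⟩
  · rintro rfl
    exact hv0 rfl
  · exact (congrArg Subtype.val ha).symm

/-- In a simple Lie algebra, a linear functional vanishing on all brackets is zero. -/
lemma IsSimple.eq_zero_of_forall_lie [IsSimple F g]
    {l : g →ₗ[F] F} (hl : ∀ x y : g, l ⁅x, y⁆ = 0) : l = 0 := by
  have htop : ⁅(⊤ : LieIdeal F g), (⊤ : LieIdeal F g)⁆ = ⊤ := by
    refine (IsSimple.eq_bot_or_eq_top _).resolve_left fun h ↦ IsSimple.non_abelian F (L := g) ?_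
    refine ⟨fun x y ↦ ?_⟩
    have : ⁅x, y⁆ ∈ ⁅(⊤ : LieIdeal F g), (⊤ : LieIdeal F g)⁆ :=
      LieSubmodule.lie_mem_lie (LieSubmodule.mem_top x) (LieSubmodule.mem_top y)
    simpa [h] using this
  have hspan := LieSubmodule.lieIdeal_oper_eq_linear_span' (R := F)
    (⊤ : LieIdeal F g) (⊤ : LieIdeal F g)
  rw [htop] at hspan
  refine LinearMap.ext_on (s := {⁅x, n⁆ | (x ∈ (⊤ : LieIdeal F g)) (n ∈ (⊤ : LieIdeal F g))})
    (by rw [← hspan]; rfl) ?_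
  rintro - ⟨x, -, y, -, rfl⟩
  simpa using hl x y

lemma IsSimple.eq_zero_of_forall_lie_eq_zero [IsSimple F g]
    {y : g} (hy : ∀ x : g, ⁅x, y⁆ = 0) : y = 0 := by
  have : y ∈ center F g := (LieModule.mem_maxTrivSubmodule F g g y).2 hy
  simpa using this

end LieAlgebra

end Centroid

section Affine

variable {F g K : Type*} [Field F] [LieRing g] [LieAlgebra F g] [LieRing K] [LieAlgebra F K]

open Finsupp

/-- The coordinates of a bracket with a loop element `x ⊗ tᵐ`, where `g ⊗ F[t,t⁻¹]` is regarded as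
the space of finitely supported functions `ℤ → g`. -/
lemma affine_lie_apply (E : ((ℤ →₀ g) × F) ≃ₗ[F] K)
    (hc : ∀ k : K, ⁅k, E (0, 1)⁆ = 0)
    (hbr : ∀ (x y : g) (m n : ℤ), ⁅E (single m x, 0), E (single n y, 0)⁆ =
      E (single (m + n) ⁅x, y⁆, 0) +
        (if m + n = 0 then (m : F) * killingForm F g x y else 0) • E (0, 1))
    (x : g) (m : ℤ) (z : K) :
    (∀ n : ℤ, (E.symm ⁅E (single m x, 0), z⁆).1 (m + n) = ⁅x, (E.symm z).1 n⁆) ∧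
      (E.symm ⁅E (single m x, 0), z⁆).2 = m * killingForm F g x ((E.symm z).1 (-m)) := by
  obtain ⟨⟨f, s⟩, rfl⟩ := E.surjective z
  have hs : E (f, s) = E (f, 0) + s • E (0, 1) := by
    rw [← map_smul, ← map_add]; simp
  rw [hs, lie_add, lie_smul, hc, smul_zero, add_zero, ← hs, E.symm_apply_apply]
  induction f using Finsupp.induction_linear generalizing s with
  | zero =>
    rw [show ((0 : ℤ →₀ g), (0 : F)) = 0 from rfl]
    simp
  | add f₁ f₂ h₁ h₂ =>
    have hadd : E (f₁ + f₂, 0) = E (f₁, 0) + E (f₂, 0) := by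
      rw [← map_add]; simp
    rw [hadd, lie_add, map_add]
    have h₁ := h₁ 0 (by simp)
    have h₂ := h₂ 0 (by simp)
    refine ⟨fun n ↦ ?_, ?_⟩
    · simp [h₁.1 n, h₂.1 n]
    · simp [h₁.2, h₂.2, mul_add]
  | single n y =>
    rw [hbr, map_add, map_smul, E.symm_apply_apply, E.symm_apply_apply]
    refine ⟨fun k ↦ ?_, ?_⟩
    · by_cases h : n = k <;> split_ifs <;> simp [h]
    · by_cases h : n = -m
      · simp [h]
      · have h' : m + n ≠ 0 := fun h' ↦ h (by lia)
        simp [h, h']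

/-- The centroid of the derived affine algebra consists of scalars, with `g ⊗ F[t,t⁻¹]` regarded as
the space of finitely supported functions `ℤ → g`. -/
theorem centroid_affine_of_finsupp
    [CharZero F] [FiniteDimensional F g] [LieAlgebra.IsSimple F g]
    (H : LieSubalgebra F g) [H.IsCartanSubalgebra] [LieModule.IsTriangularizable F H g]
    (E : ((ℤ →₀ g) × F) ≃ₗ[F] K)
    (hc : ∀ k : K, ⁅k, E (0, 1)⁆ = 0)
    (hbr : ∀ (x y : g) (m n : ℤ), ⁅E (single m x, 0), E (single n y, 0)⁆ =
      E (single (m + n) ⁅x, y⁆, 0) +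
        (if m + n = 0 then (m : F) * killingForm F g x y else 0) • E (0, 1))
    (χ : Module.End F K) (hχ : ∀ u v : K, χ ⁅u, v⁆ = ⁅u, χ v⁆) :
    ∃ a : F, χ = a • (1 : Module.End F K) := by
  have hcoord := affine_lie_apply E hc hbr
  have hχc (k : ℤ) : (E.symm (χ (E (0, 1)))).1 k = 0 := by
    refine LieAlgebra.IsSimple.eq_zero_of_forall_lie_eq_zero (F := F) fun x ↦ ?_
    rw [← (hcoord x 0 _).1 k, ← hχ, hc]
    simp
  set γ : F := (E.symm (χ (E (0, 1)))).2 with hγ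
  have hdeg (k n : ℤ) : ∃ a : F, ∀ x, (E.symm (χ (E (single n x, 0)))).1 k = a • x := by
    let φ : Module.End F g :=
      Finsupp.lapply k ∘ₗ LinearMap.fst F _ _ ∘ₗ E.symm.toLinearMap ∘ₗ χ ∘ₗ E.toLinearMap ∘ₗ
        LinearMap.inl F _ _ ∘ₗ Finsupp.lsingle n
    have hφ (x : g) : φ x = (E.symm (χ (E (single n x, 0)))).1 k := rfl
    simp_rw [← hφ]
    refine LieAlgebra.IsSimple.exists_eq_smul_of_centroid H fun x y ↦ ?_
    rw [hφ, hφ, ← (hcoord x 0 _).1 k, ← hχ, hbr]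
    simp
  choose A hA using hdeg
  have hlie (x y : g) (m n : ℤ) : χ (E (single (m + n) ⁅x, y⁆, 0)) +
      (if m + n = 0 then (m : F) * killingForm F g x y else 0) • χ (E (0, 1)) =
      ⁅E (single m x, 0), χ (E (single n y, 0))⁆ := by
    rw [← hχ, hbr, map_add, map_smul]
  have hAshift (m k n : ℤ) : A (m + k) (m + n) = A k n := by
    obtain ⟨x, y, hxy⟩ : ∃ x y : g, ⁅x, y⁆ ≠ 0 := by
      by_contra! h
      exact LieAlgebra.IsSimple.non_abelian F (L := g) ⟨h⟩
    have h := congrArg (fun z ↦ (E.symm z).1 (m + k)) (hlie x y m n)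
    simp only [map_add, map_smul, Prod.fst_add, Prod.smul_fst, Finsupp.add_apply,
      Finsupp.smul_apply, hχc, smul_zero, add_zero, (hcoord x m _).1 k, hA, lie_smul] at h
    exact smul_left_injective F hxy h
  have hA2 (x y : g) (m n : ℤ) : (E.symm (χ (E (single (m + n) ⁅x, y⁆, 0)))).2 +
      (if m + n = 0 then (m : F) * killingForm F g x y else 0) * γ =
      m * (A (-m) n * killingForm F g x y) := by
    have h := congrArg (fun z ↦ (E.symm z).2) (hlie x y m n)
    simpa only [map_add, map_smul, Prod.snd_add, Prod.smul_snd, (hcoord x m _).2, hA,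
      smul_eq_mul] using h
  have hcomp (s : ℤ) (z : g) : (E.symm (χ (E (single s z, 0)))).2 = 0 := by
    let l : g →ₗ[F] F := LinearMap.snd F _ _ ∘ₗ E.symm.toLinearMap ∘ₗ χ ∘ₗ E.toLinearMap ∘ₗ
        LinearMap.inl F _ _ ∘ₗ Finsupp.lsingle s
    have hl : l = 0 := LieAlgebra.IsSimple.eq_zero_of_forall_lie fun x y ↦ by
      change (E.symm (χ (E (single s ⁅x, y⁆, 0)))).2 = 0
      simpa using hA2 x y 0 s
    exact LinearMap.congr_fun hl z
  obtain ⟨x, y, hxy⟩ : ∃ x y : g, killingForm F g x y ≠ 0 := by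
    by_contra! h
    have := LieAlgebra.IsSimple.nontrivial F (L := g)
    obtain ⟨x, hx⟩ := exists_ne (0 : g)
    exact hx ((LieAlgebra.IsKilling.killingForm_nondegenerate F g).1 x (h x))
  have hAeq (k n : ℤ) : A k n = if k = n then γ else 0 := by
    have h := hA2 x y 1 (n - k - 1)
    have hs := hAshift (k + 1) (-1) (n - k - 1)
    rw [show k + 1 + -1 = k by ring, show k + 1 + (n - k - 1) = n by ring] at hs
    rw [hcomp, ← hs] at h
    by_cases hkn : k = n
    · subst hkn
      refine mul_right_cancel₀ hxy (a := A k k) ?_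
      simpa [mul_comm] using h.symm
    · have : (1 : ℤ) + (n - k - 1) ≠ 0 := by lia
      simp only [this, if_false, zero_mul, zero_add] at h
      simp only [hkn, if_false]
      simpa [hxy] using h.symm
  refine ⟨γ, ?_⟩
  have hloop (n : ℤ) (z : g) : χ (E (single n z, 0)) = γ • E (single n z, 0) := by
    refine E.symm.injective (Prod.ext (Finsupp.ext fun k ↦ ?_) ?_)
    · rw [hA, hAeq, map_smul, E.symm_apply_apply]
      by_cases h : k = n
      · simp [h]
      · simp [h]
    · rw [hcomp, map_smul, E.symm_apply_apply]
      simp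
  have hcen : χ (E (0, 1)) = γ • E (0, 1) := by
    refine E.symm.injective (Prod.ext (Finsupp.ext fun k ↦ ?_) ?_)
    · rw [hχc, map_smul, E.symm_apply_apply]
      simp
    · rw [map_smul, E.symm_apply_apply, ← hγ]
      simp
  have : χ ∘ₗ E.toLinearMap = (γ • (1 : Module.End F K)) ∘ₗ E.toLinearMap := by
    ext : 1
    · ext n z
      simpa using hloop n z
    · ext
      simpa using hcen
  exact (LinearMap.cancel_right E.surjective).1 this

end Affine

/-- The derived algebra `K = (g ⊗ F[t,t⁻¹]) ⊕ F c` of an untwisted affine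
Kac-Moody algebra, where `g` is a finite-dimensional split simple Lie algebra
over a field `F` of characteristic `0`, `c` is central and
`[x ⊗ tᵐ, y ⊗ tⁿ] = [x,y] ⊗ t^{m+n} + (x|y) m δ_{m,-n} c` with `(·|·)` the
Killing form, has centroid `F·id`. -/
theorem centroid_affine_derived_algebra
    (F g K : Type*) [Field F] [CharZero F]
    [LieRing g] [LieAlgebra F g] [FiniteDimensional F g] [LieAlgebra.IsSimple F g]
    -- g is split: it has a splitting Cartan subalgebra
    (hsplit : ∃ H : LieSubalgebra F g, H.IsCartanSubalgebra ∧
      LieModule.IsTriangularizable F H g)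
    [LieRing K] [LieAlgebra F K]
    -- K = (g ⊗ F[t,t⁻¹]) ⊕ F c as a vector space
    (e : ((g ⊗[F] LaurentPolynomial F) × F) ≃ₗ[F] K)
    -- c := e (0, 1) is central
    (hc : ∀ k : K, ⁅k, e (0, 1)⁆ = 0)
    -- the bracket on loop elements
    (hbr : ∀ (x y : g) (m n : ℤ),
      ⁅e (x ⊗ₜ T m, 0), e (y ⊗ₜ T n, 0)⁆ =
        e (⁅x, y⁆ ⊗ₜ T (m + n), 0) +
          (if m + n = 0 then (m : F) * killingForm F g x y else 0) • e (0, 1))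
    (χ : Module.End F K) (hχ : ∀ u v : K, χ ⁅u, v⁆ = ⁅u, χ v⁆) :
    ∃ a : F, χ = a • (1 : Module.End F K) := by
  obtain ⟨H, hH, hT⟩ := hsplit
  let Φ : (g ⊗[F] LaurentPolynomial F) ≃ₗ[F] (ℤ →₀ g) :=
    TensorProduct.congr (LinearEquiv.refl F g) (AddMonoidAlgebra.coeffLinearEquiv F) ≪≫ₗ
      TensorProduct.finsuppScalarRight F F g ℤ
  have hΦ (m : ℤ) (x : g) : Φ.symm (Finsupp.single m x) = x ⊗ₜ T m := by
    rw [LinearEquiv.symm_apply_eq]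
    ext i
    simp [Φ, Finsupp.single_apply]
  refine centroid_affine_of_finsupp H ((Φ.prodCongr (LinearEquiv.refl F F)).symm ≪≫ₗ e)
    ?_ ?_ χ hχ
  · simpa using hc
  · simpa [hΦ] using hbr
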